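/- arXiv:1905.10844 — 3 statements merged into one kernel-verified Lean document; each statement's English description precedes it below -/
import Mathlib

section
/- Let d ∈ ℕ, 0 < λ < d/2, γ ∈ (0,1/2), W(x,y) = |x−y|^{−λ} on Q×Q with Q = [0,1]^d, let h = 1/n, W̃ₙ = min(n^{dγ}, W), and let Wₙ be the piecewise-constant cell-average approximation of W̃ₙ on the grid of cubes of side h in Q×Q. Then there is a constant C independent of n such that ‖W − Wₙ‖_{L²(Q²)} ≤ C max( h^{dγ(d/(2λ) − 1)}, h^{1 − dγ(1 + 1/λ)} ). -/
open MeasureTheory Set ProbabilityTheory Filter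

noncomputable section

/-- The unit cube `Q = [0,1]^d ⊂ ℝ^d`. -/
def cube (d : ℕ) : Set (Fin d → ℝ) := Set.Icc 0 1

/-- The grid cell `Q_{n,ī} = ∏ₖ [iₖ/n, (iₖ+1)/n)` (with 0-based multi-index `ī`). -/
def cell (d n : ℕ) (i : Fin d → Fin n) : Set (Fin d → ℝ) :=
  Set.univ.pi fun k => Set.Ico ((i k : ℝ) / n) (((i k : ℝ) + 1) / n)

/-- The step function taking the value `c ī` on the cell `Q_{n,ī}`. -/
def stepOf (d n : ℕ) (c : (Fin d → Fin n) → ℝ) (x : Fin d → ℝ) : ℝ :=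
  ∑ i : Fin d → Fin n, (cell d n i).indicator (fun _ => c i) x

/-- The cell average `n^d ∫_{Q_{n,ī}} φ`. -/
def cellAvg (d n : ℕ) (φ : (Fin d → ℝ) → ℝ) (i : Fin d → Fin n) : ℝ :=
  (n : ℝ) ^ d * ∫ x in cell d n i, φ x

/-- The piecewise-constant (cell-average) approximation of `φ` on the grid of mesh `1/n`. -/
def stepApprox (d n : ℕ) (φ : (Fin d → ℝ) → ℝ) : (Fin d → ℝ) → ℝ :=
  stepOf d n (cellAvg d n φ)

/-- The cell average `n^{2d} ∫_{Q_{n,ī}×Q_{n,j̄}} W` of a kernel on `Q×Q`. -/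
def cellAvg2 (d n : ℕ) (W : (Fin d → ℝ) → (Fin d → ℝ) → ℝ) (i j : Fin d → Fin n) : ℝ :=
  (n : ℝ) ^ (2 * d) * ∫ p in (cell d n i) ×ˢ (cell d n j), W p.1 p.2

/-- The piecewise-constant (cell-average) approximation `PₙW` of a kernel `W` on `Q×Q`. -/
def stepApprox2 (d n : ℕ) (W : (Fin d → ℝ) → (Fin d → ℝ) → ℝ) (x y : Fin d → ℝ) : ℝ :=
  ∑ i : Fin d → Fin n, ∑ j : Fin d → Fin n,
    ((cell d n i) ×ˢ (cell d n j)).indicator (fun _ => cellAvg2 d n W i j) (x, y)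

/-- The Euclidean norm of `x ∈ ℝ^d`. -/
def euclNorm {d : ℕ} (x : Fin d → ℝ) : ℝ := Real.sqrt (∑ k, (x k) ^ 2)

/-- The truncation at level `M` of the singular kernel `r ↦ r^{−λ}` (equal to `M`
at and near the singularity `r = 0`). -/
def truncKer (M lam r : ℝ) : ℝ := if r = 0 then M else min M (r ^ (-lam))

/-- Sup norm on `ℝ^d`, radial lintegral. -/
lemma radial_lint (d : ℕ) (hd : 0 < d) (s : ℝ) (hs : s < d) (δ : ℝ) (hδ : 0 < δ) :
    ∫⁻ z : Fin d → ℝ, ENNReal.ofReal ((Set.Iio δ).indicator (fun r : ℝ => r ^ (-s)) ‖z‖) =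
      ENNReal.ofReal ((d : ℝ) * (volume : Measure (Fin d → ℝ)).real (Metric.ball 0 1) /
        ((d : ℝ) - s) * δ ^ ((d : ℝ) - s)) := by
  have : Nonempty (Fin d) := ⟨⟨0, hd⟩⟩
  have hfin : Module.finrank ℝ (Fin d → ℝ) = d := by simp
  have hds : 0 < (d : ℝ) - s := by linarith
  have hpt : ∀ y ∈ Set.Ioi (0 : ℝ), y ^ (d - 1) • (Set.Iio δ).indicator (fun r : ℝ => r ^ (-s)) y
      = (Set.Iio δ).indicator (fun r : ℝ => r ^ ((d : ℝ) - s - 1)) y := by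
    intro y hy
    have hy' : 0 < y := hy
    by_cases h : y ∈ Set.Iio δ
    · rw [Set.indicator_of_mem h, Set.indicator_of_mem h, smul_eq_mul, ← Real.rpow_natCast,
        ← Real.rpow_add hy', Nat.cast_sub hd]
      congr 1
      push_cast
      ring
    · rw [Set.indicator_of_notMem h, Set.indicator_of_notMem h, smul_zero]
  have hset : Set.Iio δ ∩ Set.Ioi 0 = Set.Ioo 0 δ := by
    ext; simp [and_comm]
  have hint : IntegrableOn (fun y : ℝ => y ^ (d - 1) •
      (Set.Iio δ).indicator (fun r : ℝ => r ^ (-s)) y) (Set.Ioi 0) := by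
    rw [integrableOn_congr_fun hpt measurableSet_Ioi, IntegrableOn,
      integrable_indicator_iff measurableSet_Iio, IntegrableOn,
      Measure.restrict_restrict measurableSet_Iio, hset]
    have := (intervalIntegral.intervalIntegrable_rpow' (a := 0) (b := δ)
      (r := (d : ℝ) - s - 1) (by linarith))
    rw [intervalIntegrable_iff_integrableOn_Ioo_of_le hδ.le] at this
    exact this
  have hI : ∫ y in Set.Ioi (0 : ℝ), y ^ (d - 1) •
      (Set.Iio δ).indicator (fun r : ℝ => r ^ (-s)) y = δ ^ ((d : ℝ) - s) / ((d : ℝ) - s) := by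
    rw [setIntegral_congr_fun measurableSet_Ioi hpt, integral_indicator measurableSet_Iio,
      Measure.restrict_restrict measurableSet_Iio, hset, ← integral_Ioc_eq_integral_Ioo,
      ← intervalIntegral.integral_of_le hδ.le, integral_rpow (Or.inl (by linarith))]
    rw [sub_add_cancel, Real.zero_rpow hds.ne', sub_zero]
  rw [← ofReal_integral_eq_lintegral_ofReal]
  · rw [integral_fun_norm_addHaar (volume : Measure (Fin d → ℝ))
      ((Set.Iio δ).indicator (fun r : ℝ => r ^ (-s))), hfin, hI]
    congr 1
    simp only [nsmul_eq_mul, smul_eq_mul]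
    ring
  · refine (integrable_fun_norm_addHaar (volume : Measure (Fin d → ℝ))).2 ?_
    rw [hfin]; exact hint
  · refine Filter.Eventually.of_forall fun z => ?_
    refine Set.indicator_apply_nonneg fun _ => ?_
    exact Real.rpow_nonneg (norm_nonneg _) _

lemma euclNorm_eq {d : ℕ} (x : Fin d → ℝ) : euclNorm x = ‖WithLp.toLp 2 x‖ := by
  simp [euclNorm, EuclideanSpace.norm_eq]

lemma norm_le_euclNorm {d : ℕ} (x : Fin d → ℝ) : ‖x‖ ≤ euclNorm x := by
  refine (pi_norm_le_iff_of_nonneg (Real.sqrt_nonneg _)).2 fun k => ?_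
  refine Real.le_sqrt_of_sq_le ?_
  rw [Real.norm_eq_abs, sq_abs]
  exact Finset.single_le_sum (f := fun k => x k ^ 2) (fun i _ => sq_nonneg _) (Finset.mem_univ k)

lemma euclNorm_le {d : ℕ} (x : Fin d → ℝ) (h : ℝ) (hh : 0 ≤ h) (hx : ∀ k, |x k| ≤ h) :
    euclNorm x ≤ Real.sqrt d * h := by
  unfold euclNorm
  rw [← Real.sqrt_sq hh, ← Real.sqrt_mul (Nat.cast_nonneg d)]
  refine Real.sqrt_le_sqrt ?_
  calc ∑ k, x k ^ 2 ≤ ∑ _k : Fin d, h ^ 2 :=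
        Finset.sum_le_sum fun k _ => sq_le_sq' (neg_le_of_abs_le (hx k)) (le_of_abs_le (hx k))
    _ = d * h ^ 2 := by simp

lemma euclNorm_sub_abs {d : ℕ} (x y x' y' : Fin d → ℝ) :
    |euclNorm (x - y) - euclNorm (x' - y')| ≤ euclNorm (x - x') + euclNorm (y - y') := by
  simp only [euclNorm_eq]
  refine (abs_norm_sub_norm_le _ _).trans ?_
  have : WithLp.toLp 2 (x - y) - WithLp.toLp 2 (x' - y') =
      WithLp.toLp 2 (x - x') - WithLp.toLp 2 (y - y') := by
    simp only [WithLp.toLp_sub]; abel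
  rw [this]
  exact norm_sub_le _ _

lemma continuous_euclNorm {d : ℕ} : Continuous (euclNorm (d := d)) := by
  unfold euclNorm; fun_prop

lemma truncKer_eq (M lam r : ℝ) (hM : 0 < M) (hl : 0 < lam) (hr : 0 ≤ r) :
    truncKer M lam r = (max r (M ^ (-1 / lam))) ^ (-lam) := by
  have hδ : 0 < M ^ (-1 / lam) := Real.rpow_pos_of_pos hM _
  have hMδ : (M ^ (-1 / lam)) ^ (-lam) = M := by
    rw [← Real.rpow_mul hM.le]
    have : -1 / lam * -lam = 1 := by field_simp
    rw [this, Real.rpow_one]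
  unfold truncKer
  split_ifs with h
  · rw [h, max_eq_right hδ.le, hMδ]
  · have hr' : 0 < r := lt_of_le_of_ne hr (Ne.symm h)
    rcases le_total r (M ^ (-1 / lam)) with h1 | h1
    · rw [max_eq_right h1, hMδ, min_eq_left]
      have := Real.rpow_le_rpow_of_nonpos hr' h1 (by linarith : -lam ≤ 0)
      rwa [hMδ] at this
    · rw [max_eq_left h1, min_eq_right]
      have := Real.rpow_le_rpow_of_nonpos hδ h1 (by linarith : -lam ≤ 0)
      rwa [hMδ] at this

lemma rpow_lip (δ lam : ℝ) (hδ : 0 < δ) (hl : 0 < lam) (r s : ℝ) :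
    |(max r δ) ^ (-lam) - (max s δ) ^ (-lam)| ≤ lam * δ ^ (-lam - 1) * |r - s| := by
  have h := Convex.norm_image_sub_le_of_norm_hasDerivWithin_le (𝕜 := ℝ)
    (f := fun x : ℝ => x ^ (-lam)) (f' := fun x : ℝ => -lam * x ^ (-lam - 1))
    (s := Set.Ici δ) (C := lam * δ ^ (-lam - 1)) (x := max s δ) (y := max r δ)
    (fun x hx => (Real.hasDerivAt_rpow_const (Or.inl (hδ.trans_le hx).ne')).hasDerivWithinAt)
    (fun x hx => by
      have hx0 : 0 < x := hδ.trans_le hx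
      rw [norm_mul, norm_neg, Real.norm_of_nonneg hl.le,
        Real.norm_of_nonneg (Real.rpow_nonneg hx0.le _)]
      exact mul_le_mul_of_nonneg_left
        (Real.rpow_le_rpow_of_nonpos hδ hx (by linarith)) hl.le)
    (convex_Ici δ) (Set.mem_Ici.2 (le_max_right _ _)) (Set.mem_Ici.2 (le_max_right _ _))
  rw [Real.norm_eq_abs, Real.norm_eq_abs] at h
  refine h.trans (mul_le_mul_of_nonneg_left ?_ (mul_nonneg hl.le (Real.rpow_nonneg hδ.le _)))
  exact abs_max_sub_max_le_abs r s δ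

lemma cell_disj {d n : ℕ} (hn : 0 < n) {i j : Fin d → Fin n} {x : Fin d → ℝ}
    (hi : x ∈ cell d n i) (hj : x ∈ cell d n j) : i = j := by
  have hn' : (0 : ℝ) < n := by exact_mod_cast hn
  funext k
  have h1 := hi k (Set.mem_univ _)
  have h2 := hj k (Set.mem_univ _)
  simp only [Set.mem_Ico, div_le_iff₀ hn', lt_div_iff₀ hn'] at h1 h2
  have a : ((i k : ℕ) : ℝ) < (j k : ℕ) + 1 := by linarith
  have b : ((j k : ℕ) : ℝ) < (i k : ℕ) + 1 := by linarith
  norm_cast at a b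
  exact Fin.ext (by omega)

lemma exists_cell {d n : ℕ} (hn : 0 < n) {x : Fin d → ℝ}
    (hx : x ∈ Set.univ.pi fun _ : Fin d => Set.Ico (0 : ℝ) 1) : ∃ i, x ∈ cell d n i := by
  have hn' : (0 : ℝ) < n := by exact_mod_cast hn
  have h : ∀ k, 0 ≤ x k ∧ x k < 1 := fun k => hx k (Set.mem_univ _)
  refine ⟨fun k => ⟨⌊x k * n⌋₊, ?_⟩, fun k _ => ?_⟩
  · rw [Nat.floor_lt (mul_nonneg (h k).1 hn'.le)]
    nlinarith [(h k).2]
  · simp only [Set.mem_Ico, div_le_iff₀ hn', lt_div_iff₀ hn']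
    exact ⟨Nat.floor_le (mul_nonneg (h k).1 hn'.le), Nat.lt_floor_add_one _⟩

lemma stepApprox2_eq {d n : ℕ} (hn : 0 < n) (W : (Fin d → ℝ) → (Fin d → ℝ) → ℝ)
    {i j : Fin d → Fin n} {x y : Fin d → ℝ} (hx : x ∈ cell d n i) (hy : y ∈ cell d n j) :
    stepApprox2 d n W x y = cellAvg2 d n W i j := by
  unfold stepApprox2
  rw [Finset.sum_eq_single i, Finset.sum_eq_single j]
  · rw [Set.indicator_of_mem (Set.mk_mem_prod hx hy)]
  · intro j' _ hj'
    exact Set.indicator_of_notMem (fun h => hj' (cell_disj hn h.2 hy)) _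
  · simp
  · intro i' _ hi'
    exact Finset.sum_eq_zero fun j' _ =>
      Set.indicator_of_notMem (fun h => hi' (cell_disj hn h.1 hx)) _
  · simp

lemma vol_cell {d n : ℕ} (hn : 0 < n) (i : Fin d → Fin n) :
    volume (cell d n i) = ENNReal.ofReal (((n : ℝ)⁻¹) ^ d) := by
  have hn' : (0 : ℝ) < n := by exact_mod_cast hn
  unfold cell
  rw [Real.volume_pi_Ico]
  have : ∀ k, ((i k : ℝ) + 1) / n - (i k : ℝ) / n = (n : ℝ)⁻¹ := fun k => by field_simp; ring
  simp only [this, Finset.prod_const, Finset.card_univ, Fintype.card_fin]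
  rw [ENNReal.ofReal_pow (by positivity)]

lemma avg_bound {d n : ℕ} (hn : 0 < n) (W : (Fin d → ℝ) → (Fin d → ℝ) → ℝ)
    (hW : Continuous fun p : (Fin d → ℝ) × (Fin d → ℝ) => W p.1 p.2) (K : ℝ)
    {i j : Fin d → Fin n} {x y : Fin d → ℝ}
    (hK : ∀ x' ∈ cell d n i, ∀ y' ∈ cell d n j, |W x y - W x' y'| ≤ K) :
    |W x y - cellAvg2 d n W i j| ≤ K := by
  have hn' : (0 : ℝ) < n := by exact_mod_cast hn
  set S := cell d n i ×ˢ cell d n j with hS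
  have hmeas : MeasurableSet S :=
    (MeasurableSet.univ_pi fun _ => measurableSet_Ico).prod
      (MeasurableSet.univ_pi fun _ => measurableSet_Ico)
  have hvol : volume S = ENNReal.ofReal (((n : ℝ)⁻¹) ^ (2 * d)) := by
    rw [hS, Measure.volume_eq_prod, Measure.prod_prod, vol_cell hn, vol_cell hn,
      ← ENNReal.ofReal_mul (by positivity), two_mul, pow_add]
  have hfin : volume S < ⊤ := by rw [hvol]; exact ENNReal.ofReal_lt_top
  have hreal : volume.real S = ((n : ℝ)⁻¹) ^ (2 * d) := by
    rw [Measure.real, hvol, ENNReal.toReal_ofReal (by positivity)]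
  have hcst : IntegrableOn (fun _ : (Fin d → ℝ) × (Fin d → ℝ) => W x y) S :=
    integrableOn_const hfin.ne
  have hWi : IntegrableOn (fun p : (Fin d → ℝ) × (Fin d → ℝ) => W p.1 p.2) S := by
    refine IntegrableOn.of_bound hfin hW.aestronglyMeasurable (|W x y| + K) ?_
    refine (ae_restrict_iff' hmeas).2 (Filter.Eventually.of_forall fun p hp => ?_)
    have h1 := hK p.1 hp.1 p.2 hp.2
    rw [Real.norm_eq_abs]
    have h2 := abs_sub_abs_le_abs_sub (W p.1 p.2) (W x y)
    rw [abs_sub_comm] at h2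
    linarith
  have hone : (n : ℝ) ^ (2 * d) * ((n : ℝ)⁻¹) ^ (2 * d) = 1 := by
    rw [← mul_pow, mul_inv_cancel₀ hn'.ne', one_pow]
  have key : W x y - cellAvg2 d n W i j =
      (n : ℝ) ^ (2 * d) * ∫ p in S, (W x y - W p.1 p.2) := by
    rw [integral_sub hcst hWi, setIntegral_const, hreal, smul_eq_mul, mul_sub, ← mul_assoc, hone,
      one_mul]
    rfl
  rw [key, abs_mul, abs_of_nonneg (by positivity)]
  have := norm_setIntegral_le_of_norm_le_const hfin
    (f := fun p : (Fin d → ℝ) × (Fin d → ℝ) => W x y - W p.1 p.2) (C := K)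
    (fun p hp => hK p.1 hp.1 p.2 hp.2)
  rw [hreal, Real.norm_eq_abs] at this
  calc _ ≤ (n : ℝ) ^ (2 * d) * (K * ((n : ℝ)⁻¹) ^ (2 * d)) :=
        mul_le_mul_of_nonneg_left this (by positivity)
    _ = K * ((n : ℝ) ^ (2 * d) * ((n : ℝ)⁻¹) ^ (2 * d)) := by ring
    _ = K := by rw [hone, mul_one]

lemma cell_diff {d n : ℕ} {i : Fin d → Fin n} {x x' : Fin d → ℝ}
    (hx : x ∈ cell d n i) (hx' : x' ∈ cell d n i) :
    euclNorm (x - x') ≤ Real.sqrt d * (n : ℝ)⁻¹ := by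
  refine euclNorm_le _ _ (by positivity) fun k => ?_
  have h1 := hx k (Set.mem_univ _)
  have h2 := hx' k (Set.mem_univ _)
  simp only [Set.mem_Ico, add_div, one_div] at h1 h2
  rw [Pi.sub_apply, abs_le]
  constructor <;> linarith

lemma vol_Q (d : ℕ) : volume (Set.univ.pi fun _ : Fin d => Set.Ico (0 : ℝ) 1) = 1 := by
  rw [Real.volume_pi_Ico]; simp

/-- The `L²` norm of the singular part. -/
lemma sing_bound (d : ℕ) (hd : 0 < d) (lam : ℝ) (hl : 2 * lam < d) (δ : ℝ) (hδ : 0 < δ)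
    (Q : Set (Fin d → ℝ)) (hQ : volume Q = 1) :
    eLpNorm (fun p : (Fin d → ℝ) × (Fin d → ℝ) =>
        (Set.Iio δ).indicator (fun r : ℝ => r ^ (-lam)) ‖p.1 - p.2‖) 2
        (volume.restrict (Q ×ˢ Q)) ≤
      ENNReal.ofReal (Real.sqrt ((d : ℝ) * (volume : Measure (Fin d → ℝ)).real (Metric.ball 0 1) /
        ((d : ℝ) - 2 * lam)) * δ ^ ((d : ℝ) / 2 - lam)) := by
  have hmeas : Measurable ((Set.Iio δ).indicator (fun r : ℝ => r ^ (-(2 * lam)))) :=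
    Measurable.indicator (by fun_prop) measurableSet_Iio
  have hg : Measurable (fun z : Fin d → ℝ =>
      ENNReal.ofReal ((Set.Iio δ).indicator (fun r : ℝ => r ^ (-(2 * lam))) ‖z‖)) :=
    (hmeas.comp measurable_norm).ennreal_ofReal
  have hds : 0 < (d : ℝ) - 2 * lam := by linarith
  have hsq : ∀ p : (Fin d → ℝ) × (Fin d → ℝ),
      ‖(Set.Iio δ).indicator (fun r : ℝ => r ^ (-lam)) ‖p.1 - p.2‖‖ₑ ^ (2 : ℝ) =
      ENNReal.ofReal ((Set.Iio δ).indicator (fun r : ℝ => r ^ (-(2 * lam))) ‖p.1 - p.2‖) := by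
    intro p
    by_cases h : ‖p.1 - p.2‖ ∈ Set.Iio δ
    · rw [Set.indicator_of_mem h, Set.indicator_of_mem h,
        Real.enorm_of_nonneg (Real.rpow_nonneg (norm_nonneg _) _),
        ENNReal.ofReal_rpow_of_nonneg (Real.rpow_nonneg (norm_nonneg _) _) (by norm_num),
        ← Real.rpow_mul (norm_nonneg _)]
      congr 2
      ring
    · rw [Set.indicator_of_notMem h, Set.indicator_of_notMem h]
      simp
  rw [eLpNorm_eq_lintegral_rpow_enorm_toReal two_ne_zero ENNReal.ofNat_ne_top]
  simp only [ENNReal.toReal_ofNat]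
  simp_rw [hsq]
  have hle : ∫⁻ p in Q ×ˢ Q, ENNReal.ofReal ((Set.Iio δ).indicator
      (fun r : ℝ => r ^ (-(2 * lam))) ‖p.1 - p.2‖) ≤
      ∫⁻ z : Fin d → ℝ, ENNReal.ofReal ((Set.Iio δ).indicator
      (fun r : ℝ => r ^ (-(2 * lam))) ‖z‖) := by
    have hgm : Measurable (fun p : (Fin d → ℝ) × (Fin d → ℝ) =>
        ENNReal.ofReal ((Set.Iio δ).indicator (fun r : ℝ => r ^ (-(2 * lam))) ‖p.1 - p.2‖)) :=
      hg.comp (measurable_fst.sub measurable_snd)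
    rw [Measure.volume_eq_prod, ← Measure.prod_restrict, lintegral_prod _ hgm.aemeasurable]
    calc _ ≤ ∫⁻ _x in Q, ∫⁻ z : Fin d → ℝ, ENNReal.ofReal ((Set.Iio δ).indicator
            (fun r : ℝ => r ^ (-(2 * lam))) ‖z‖) := by
          refine lintegral_mono fun x => ?_
          refine (setLIntegral_le_lintegral _ _).trans ?_
          exact (lintegral_sub_left_eq_self (fun z : Fin d → ℝ =>
            ENNReal.ofReal ((Set.Iio δ).indicator
            (fun r : ℝ => r ^ (-(2 * lam))) ‖z‖)) x).le
      _ = _ := by rw [setLIntegral_const, hQ, mul_one]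
  rw [radial_lint d hd (2 * lam) hl δ hδ] at hle
  refine (ENNReal.rpow_le_rpow hle (by norm_num)).trans ?_
  have h0 : 0 ≤ (d : ℝ) * (volume : Measure (Fin d → ℝ)).real (Metric.ball 0 1) /
        ((d : ℝ) - 2 * lam) := by positivity
  rw [ENNReal.ofReal_rpow_of_nonneg (by positivity) (by norm_num),
    Real.mul_rpow h0 (by positivity), ← Real.sqrt_eq_rpow, ← Real.rpow_mul hδ.le]
  refine le_of_eq ?_
  congr 3
  ring

set_option maxHeartbeats 1000000 in
/-- Lemma 4.2: for the singular graphon `W(x,y) = |x−y|^{−λ}` on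
`Q×Q`, `0 < λ < d/2`, `γ ∈ (0,1/2)`, with `h = 1/n`, `W̃ₙ = min(n^{dγ}, W)` and `Wₙ`
the cell-average approximation of `W̃ₙ`:
`‖W − Wₙ‖_{L²(Q²)} ≤ C max( h^{dγ(d/(2λ)−1)}, h^{1−dγ(1+1/λ)} )` with `C` independent of `n`. -/
theorem singular_graphon_approx_rate
    (d : ℕ) (hd : 0 < d) (lam γ : ℝ)
    (hlam : 0 < lam ∧ lam < (d : ℝ) / 2) (hγ : γ ∈ Set.Ioo (0:ℝ) (1/2)) :
    ∃ C > 0, ∀ n : ℕ, 0 < n →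
      eLpNorm
          (fun p : (Fin d → ℝ) × (Fin d → ℝ) =>
            euclNorm (p.1 - p.2) ^ (-lam) -
              stepApprox2 d n
                (fun x y => truncKer ((n : ℝ) ^ ((d : ℝ) * γ)) lam (euclNorm (x - y)))
                p.1 p.2)
          2 (volume.restrict ((cube d) ×ˢ (cube d)))
        ≤ ENNReal.ofReal
            (C * max (((n : ℝ)⁻¹) ^ ((d : ℝ) * γ * ((d : ℝ) / (2 * lam) - 1)))
              (((n : ℝ)⁻¹) ^ (1 - (d : ℝ) * γ * (1 + 1 / lam)))) := by
  obtain ⟨hl0, hl1⟩ := hlam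
  have : Nonempty (Fin d) := ⟨⟨0, hd⟩⟩
  set C0 : ℝ := Real.sqrt ((d : ℝ) * (volume : Measure (Fin d → ℝ)).real (Metric.ball 0 1) /
        ((d : ℝ) - 2 * lam)) with hC0
  have hC0n : 0 ≤ C0 := Real.sqrt_nonneg _
  have hC1 : 0 ≤ lam * (2 * Real.sqrt d) := by positivity
  refine ⟨C0 + lam * (2 * Real.sqrt d) + 1, by positivity, fun n hn => ?_⟩
  have hn' : (0 : ℝ) < n := by exact_mod_cast hn
  set M : ℝ := (n : ℝ) ^ ((d : ℝ) * γ) with hM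
  have hM0 : 0 < M := Real.rpow_pos_of_pos hn' _
  set δ : ℝ := M ^ (-1 / lam) with hδd
  have hδ : 0 < δ := Real.rpow_pos_of_pos hM0 _
  have hδn : δ = ((n : ℝ)⁻¹) ^ ((d : ℝ) * γ / lam) := by
    rw [hδd, hM, ← Real.rpow_mul hn'.le, Real.inv_rpow hn'.le, ← Real.rpow_neg hn'.le]
    congr 1; ring
  set A := ((n : ℝ)⁻¹) ^ ((d : ℝ) * γ * ((d : ℝ) / (2 * lam) - 1)) with hA
  set B := ((n : ℝ)⁻¹) ^ (1 - (d : ℝ) * γ * (1 + 1 / lam)) with hB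
  have hninv : 0 < (n : ℝ)⁻¹ := by positivity
  have hA' : δ ^ ((d : ℝ) / 2 - lam) = A := by
    rw [hδn, ← Real.rpow_mul hninv.le, hA]
    congr 1; field_simp
  have hB' : δ ^ (-lam - 1) * (n : ℝ)⁻¹ = B := by
    rw [hδn, ← Real.rpow_mul hninv.le, hB]
    nth_rewrite 2 [← Real.rpow_one (n : ℝ)⁻¹]
    rw [← Real.rpow_add hninv]
    congr 1; field_simp; ring
  have hA0 : 0 ≤ A := Real.rpow_nonneg hninv.le _
  have hB0 : 0 ≤ B := Real.rpow_nonneg hninv.le _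
  set Q : Set (Fin d → ℝ) := Set.univ.pi fun _ : Fin d => Set.Ico (0 : ℝ) 1 with hQd
  have hQ : volume Q = 1 := vol_Q d
  have hQm : MeasurableSet Q := MeasurableSet.univ_pi fun _ => measurableSet_Ico
  have hQQ : Q ×ˢ Q =ᵐ[(volume : Measure ((Fin d → ℝ) × (Fin d → ℝ)))] cube d ×ˢ cube d := by
    have h1 : Q =ᵐ[(volume : Measure (Fin d → ℝ))] cube d :=
      Measure.univ_pi_Ico_ae_eq_Icc (f := (0 : Fin d → ℝ)) (g := 1)
    exact Measure.set_prod_ae_eq h1 h1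
  rw [← Measure.restrict_congr_set hQQ]
  set W : (Fin d → ℝ) → (Fin d → ℝ) → ℝ :=
    fun x y => truncKer M lam (euclNorm (x - y)) with hWd
  have hWeq : ∀ x y, W x y = (max (euclNorm (x - y)) δ) ^ (-lam) := fun x y =>
    truncKer_eq M lam _ hM0 hl0 (Real.sqrt_nonneg _)
  have hWc : Continuous fun p : (Fin d → ℝ) × (Fin d → ℝ) => W p.1 p.2 := by
    simp only [hWeq]
    refine Continuous.rpow_const ?_ fun p => Or.inl (lt_max_of_lt_right hδ).ne'
    exact (continuous_euclNorm.comp (continuous_fst.sub continuous_snd)).max continuous_const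
  set K : ℝ := lam * (2 * Real.sqrt d) * B with hK
  have hK0 : 0 ≤ K := mul_nonneg hC1 hB0
  have hne : ∀ᵐ p : (Fin d → ℝ) × (Fin d → ℝ), p.1 - p.2 ≠ 0 := by
    have h0 : ∀ᵐ z : Fin d → ℝ, z ≠ 0 := by
      simp [ae_iff]
    exact (quasiMeasurePreserving_sub (volume : Measure (Fin d → ℝ)) volume).ae h0
  set G : (Fin d → ℝ) × (Fin d → ℝ) → ℝ := fun p =>
    (Set.Iio δ).indicator (fun r : ℝ => r ^ (-lam)) ‖p.1 - p.2‖ with hG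
  have hpt : ∀ᵐ p ∂(volume.restrict (Q ×ˢ Q)),
      ‖euclNorm (p.1 - p.2) ^ (-lam) - stepApprox2 d n W p.1 p.2‖ ≤
      G p + K := by
    filter_upwards [ae_restrict_of_ae hne, ae_restrict_mem (hQm.prod hQm)] with p hp hpQ
    obtain ⟨i, hi⟩ := exists_cell hn hpQ.1
    obtain ⟨j, hj⟩ := exists_cell hn hpQ.2
    rw [stepApprox2_eq hn W hi hj]
    have h2 : |W p.1 p.2 - cellAvg2 d n W i j| ≤ K := by
      refine avg_bound hn W hWc K fun x' hx' y' hy' => ?_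
      rw [hWeq, hWeq]
      refine (rpow_lip δ lam hδ hl0 _ _).trans ?_
      have h3 := euclNorm_sub_abs p.1 p.2 x' y'
      have h4 := cell_diff hi hx'
      have h5 := cell_diff hj hy'
      calc _ ≤ lam * δ ^ (-lam - 1) * (2 * (Real.sqrt d * (n : ℝ)⁻¹)) := by
            refine mul_le_mul_of_nonneg_left (by linarith) (by positivity)
        _ = lam * (2 * Real.sqrt d) * (δ ^ (-lam - 1) * (n : ℝ)⁻¹) := by ring
        _ = K := by rw [hB']
    have h1 : |euclNorm (p.1 - p.2) ^ (-lam) - W p.1 p.2| ≤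
        (Set.Iio δ).indicator (fun r : ℝ => r ^ (-lam)) ‖p.1 - p.2‖ := by
      have hpos : 0 < ‖p.1 - p.2‖ := norm_pos_iff.2 hp
      have hle := norm_le_euclNorm (p.1 - p.2)
      rw [hWeq]
      rcases le_or_gt δ (euclNorm (p.1 - p.2)) with h | h
      · rw [max_eq_left h, sub_self, abs_zero]
        exact Set.indicator_apply_nonneg fun _ => (Real.rpow_nonneg hpos.le _)
      · rw [max_eq_right h.le, Set.indicator_of_mem (Set.mem_Iio.2 (hle.trans_lt h))]
        have a1 := Real.rpow_le_rpow_of_nonpos (hpos.trans_le hle) h.le (by linarith : -lam ≤ 0)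
        have a2 := Real.rpow_le_rpow_of_nonpos hpos hle (by linarith : -lam ≤ 0)
        have a3 := Real.rpow_nonneg hδ.le (-lam)
        rw [abs_of_nonneg (by linarith)]
        linarith
    rw [Real.norm_eq_abs]
    exact (abs_sub_le _ (W p.1 p.2) _).trans (add_le_add h1 h2)
  refine (eLpNorm_mono_ae_real hpt).trans ?_
  have hm1 : Measurable G := by
    have : Measurable ((Set.Iio δ).indicator (fun r : ℝ => r ^ (-lam))) :=
      Measurable.indicator (by fun_prop) measurableSet_Iio
    exact this.comp (measurable_fst.sub measurable_snd).norm
  refine (eLpNorm_add_le (f := G) (g := fun _ => K) hm1.aestronglyMeasurable aestronglyMeasurable_const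
    (by norm_num)).trans ?_
  have hs := sing_bound d hd lam (by linarith) δ hδ Q hQ
  rw [hA', ← hC0] at hs
  have hvolQ : (volume.restrict (Q ×ˢ Q) : Measure ((Fin d → ℝ) × (Fin d → ℝ))) Set.univ = 1 := by
    rw [Measure.restrict_apply_univ, Measure.volume_eq_prod, Measure.prod_prod, hQ, mul_one]
  have hc : eLpNorm (fun _ : (Fin d → ℝ) × (Fin d → ℝ) => K) 2 (volume.restrict (Q ×ˢ Q)) ≤
      ENNReal.ofReal K := by
    rw [eLpNorm_const _ two_ne_zero (fun h => by rw [h] at hvolQ; simp at hvolQ), hvolQ,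
      ENNReal.one_rpow, mul_one, Real.enorm_of_nonneg hK0]
  refine (add_le_add hs hc).trans ?_
  rw [← ENNReal.ofReal_add (mul_nonneg hC0n hA0) hK0]
  refine ENNReal.ofReal_le_ofReal ?_
  have m1 : C0 * A ≤ C0 * max A B := mul_le_mul_of_nonneg_left (le_max_left _ _) hC0n
  have m2 : K ≤ lam * (2 * Real.sqrt d) * max A B :=
    mul_le_mul_of_nonneg_left (le_max_right _ _) hC1
  have m3 : 0 ≤ max A B := le_max_of_le_left hA0
  calc _ ≤ C0 * max A B + lam * (2 * Real.sqrt d) * max A B + max A B := by linarith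
    _ = _ := by ring
end
end

section
/- Let d ∈ ℕ, 0 < λ < d/2, Q = [0,1]^d, and W(x,y) = |x−y|^{−λ}. Then there is a constant C = C(d,λ) > 0 such that for every M ≥ 1, ∫_Q ∫_Q ( |x−y|^{−λ} − M )₊² dx dy ≤ C M^{2 − d/λ}; equivalently, ‖W − min(M, W)‖_{L²(Q²)} ≤ C^{1/2} M^{1 − d/(2λ)}. -/
open MeasureTheory Set ProbabilityTheory Filter

noncomputable section

/-- Radial profile in the sup norm. -/
def radG (lam M r : ℝ) : ℝ := (max (r ^ (-lam) - M) 0) ^ 2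

lemma radG_nonneg (lam M r : ℝ) : 0 ≤ radG lam M r := sq_nonneg _

lemma radG_meas (lam M : ℝ) : Measurable (radG lam M) := by
  unfold radG; fun_prop

lemma radG_one_integrable (d : ℕ) (hd : 0 < d) (lam : ℝ) (h0 : 0 < lam) (h1 : lam < (d : ℝ) / 2) :
    Integrable (fun z : Fin d → ℝ => radG lam 1 ‖z‖) := by
  have : Nonempty (Fin d) := ⟨⟨0, hd⟩⟩
  rw [integrable_fun_norm_addHaar (μ := (volume : Measure (Fin d → ℝ))) (f := radG lam 1)]
  have hI : IntegrableOn (fun y : ℝ => y ^ ((d : ℝ) - 1 - 2 * lam)) (Ioo 0 1) := by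
    rw [intervalIntegral.integrableOn_Ioo_rpow_iff zero_lt_one]
    linarith
  have hI2 : IntegrableOn ((Ioo (0 : ℝ) 1).indicator
      (fun y : ℝ => y ^ ((d : ℝ) - 1 - 2 * lam))) (Ioi 0) :=
    ((integrable_indicator_iff measurableSet_Ioo).2 hI).integrableOn
  refine Integrable.mono' hI2 ?_ ?_
  · have := radG_meas lam 1
    exact Measurable.aestronglyMeasurable (by fun_prop)
  · refine (ae_restrict_iff' measurableSet_Ioi).2 (Eventually.of_forall fun y hy => ?_)
    have hy : 0 < y := hy
    have hnn := radG_nonneg lam 1 y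
    rw [smul_eq_mul, Real.norm_of_nonneg (by positivity)]
    by_cases hy1 : y < 1
    · rw [indicator_of_mem (show y ∈ Ioo (0:ℝ) 1 from ⟨hy, hy1⟩)]
      have hp : 0 < y ^ (-lam) := Real.rpow_pos_of_pos hy _
      have : radG lam 1 y ≤ (y ^ (-lam)) ^ 2 := by
        unfold radG
        gcongr
        exact max_le (by linarith) hp.le
      calc _ ≤ y ^ (Module.finrank ℝ (Fin d → ℝ) - 1) * (y ^ (-lam)) ^ 2 := by gcongr
        _ = _ := by
          rw [Module.finrank_fin_fun, ← Real.rpow_natCast, ← Real.rpow_natCast, ← Real.rpow_mul hy.le,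
            ← Real.rpow_add hy, Nat.cast_sub (by omega)]
          congr 1; push_cast; ring
    · rw [indicator_of_notMem (by simp [hy1])]
      have : radG lam 1 y = 0 := by
        unfold radG
        have := Real.rpow_le_one_of_one_le_of_nonpos (not_lt.1 hy1) (by linarith : -lam ≤ 0)
        rw [max_eq_right (by linarith)]; simp
      simp [this]

lemma radG_scale (lam M r : ℝ) (h0 : 0 < lam) (hM : 0 < M) (hr : 0 ≤ r) :
    radG lam M r = M ^ 2 * radG lam 1 (M ^ (1 / lam) * r) := by
  unfold radG
  have : (M ^ (1 / lam) * r) ^ (-lam) = M⁻¹ * r ^ (-lam) := by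
    rw [Real.mul_rpow (by positivity) hr, ← Real.rpow_mul hM.le]
    congr 1
    rw [show 1 / lam * -lam = -1 by field_simp, Real.rpow_neg_one]
  rw [this, ← mul_pow, mul_max_of_nonneg _ _ hM.le, mul_sub, mul_inv_cancel_left₀ hM.ne']
  simp

lemma radG_integral (d : ℕ) (hd : 0 < d) (lam M : ℝ) (h0 : 0 < lam) (h1 : lam < (d : ℝ) / 2)
    (hM : 0 < M) :
    Integrable (fun z : Fin d → ℝ => radG lam M ‖z‖) ∧
    ∫ z : Fin d → ℝ, radG lam M ‖z‖
      = M ^ (2 - (d : ℝ) / lam) * ∫ z : Fin d → ℝ, radG lam 1 ‖z‖ := by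
  have hR : 0 < M ^ (1 / lam) := by positivity
  have heq : (fun z : Fin d → ℝ => radG lam M ‖z‖)
      = fun z => M ^ 2 * (fun w : Fin d → ℝ => radG lam 1 ‖w‖) (M ^ (1 / lam) • z) := by
    funext z
    simp only [norm_smul, Real.norm_of_nonneg hR.le]
    exact radG_scale lam M _ h0 hM (norm_nonneg _)
  rw [heq]
  refine ⟨((radG_one_integrable d hd lam h0 h1).comp_smul hR.ne').const_mul _, ?_⟩
  rw [integral_const_mul, Measure.integral_comp_smul volume (fun w : Fin d → ℝ => radG lam 1 ‖w‖), abs_of_nonneg (by positivity), smul_eq_mul,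
    ← mul_assoc]
  congr 1
  rw [Module.finrank_fin_fun, ← Real.rpow_natCast (M ^ (1 / lam)), ← Real.rpow_mul hM.le,
    ← Real.rpow_neg hM.le, ← Real.rpow_natCast M 2, ← Real.rpow_add hM]
  congr 1; push_cast; ring

lemma trunc_le {d : ℕ} (lam M : ℝ) (h0 : 0 < lam) (x : Fin d → ℝ) :
    (max (euclNorm x ^ (-lam) - M) 0) ^ 2 ≤ radG lam M ‖x‖ := by
  unfold radG
  have : euclNorm x ^ (-lam) ≤ ‖x‖ ^ (-lam) := by
    by_cases hx : x = 0
    · subst hx; simp [euclNorm]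
    · exact Real.rpow_le_rpow_of_nonpos (norm_pos_iff.2 hx) (norm_le_euclNorm x) (by linarith)
  gcongr

theorem singular_kernel_truncation_error
    (d : ℕ) (hd : 0 < d) (lam : ℝ) (hlam : 0 < lam ∧ lam < (d : ℝ) / 2) :
    ∃ C > 0, ∀ M : ℝ, 1 ≤ M →
      (∫ x in cube d, ∫ y in cube d,
          (max (euclNorm (x - y) ^ (-lam) - M) 0) ^ 2)
        ≤ C * M ^ (2 - (d : ℝ) / lam) ∧
      eLpNorm
          (fun p : (Fin d → ℝ) × (Fin d → ℝ) =>
            euclNorm (p.1 - p.2) ^ (-lam) - min M (euclNorm (p.1 - p.2) ^ (-lam)))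
          2 (volume.restrict ((cube d) ×ˢ (cube d)))
        ≤ ENNReal.ofReal (Real.sqrt C * M ^ (1 - (d : ℝ) / (2 * lam))) := by
  obtain ⟨h0, h1⟩ := hlam
  have hK : 0 ≤ ∫ z : Fin d → ℝ, radG lam 1 ‖z‖ := integral_nonneg fun z => radG_nonneg _ _ _
  refine ⟨(∫ z : Fin d → ℝ, radG lam 1 ‖z‖) + 1, by positivity, fun M hM1 => ?_⟩
  have hM : 0 < M := by linarith
  obtain ⟨hint, hval⟩ := radG_integral d hd lam M h0 h1 hM
  set K := ∫ z : Fin d → ℝ, radG lam 1 ‖z‖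
  set J := ∫ z : Fin d → ℝ, radG lam M ‖z‖ with hJ
  have hJ0 : 0 ≤ J := integral_nonneg fun z => radG_nonneg _ _ _
  have hJle : J ≤ (K + 1) * M ^ (2 - (d : ℝ) / lam) := by
    have : 0 < M ^ (2 - (d : ℝ) / lam) := by positivity
    rw [hval]; nlinarith
  have hvol : (volume : Measure (Fin d → ℝ)) (cube d) = 1 := by
    unfold cube
    rw [Real.volume_Icc_pi]; simp
  have hshift : ∀ x : Fin d → ℝ, Integrable (fun y : Fin d → ℝ => radG lam M ‖x - y‖) :=
    fun x => hint.comp_sub_left x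
  have hshiftv : ∀ x : Fin d → ℝ, ∫ y : Fin d → ℝ, radG lam M ‖x - y‖ = J :=
    fun x => integral_sub_left_eq_self (fun z : Fin d → ℝ => radG lam M ‖z‖) volume x
  constructor
  · refine le_trans (le_trans (le_abs_self _) ?_) hJle
    have hb := norm_setIntegral_le_of_norm_le_const (μ := (volume : Measure (Fin d → ℝ)))
      (s := cube d) (C := J)
      (f := fun x => ∫ y in cube d, (max (euclNorm (x - y) ^ (-lam) - M) 0) ^ 2)
      (by rw [hvol]; simp) (fun x _ => ?_)
    · simpa [Measure.real, hvol] using hb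
    · rw [Real.norm_of_nonneg (integral_nonneg fun y => sq_nonneg _)]
      calc _ ≤ ∫ y in cube d, radG lam M ‖x - y‖ :=
            integral_mono_of_nonneg (Eventually.of_forall fun y => sq_nonneg _)
              (hshift x).integrableOn (Eventually.of_forall fun y => trunc_le lam M h0 _)
        _ ≤ ∫ y, radG lam M ‖x - y‖ :=
            setIntegral_le_integral (hshift x) (Eventually.of_forall fun y => radG_nonneg _ _ _)
        _ = J := hshiftv x
  · rw [eLpNorm_eq_lintegral_rpow_enorm_toReal two_ne_zero ENNReal.ofNat_ne_top]
    have hbd : ∫⁻ p in (cube d) ×ˢ (cube d),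
        ‖euclNorm (p.1 - p.2) ^ (-lam) - min M (euclNorm (p.1 - p.2) ^ (-lam))‖ₑ
          ^ (2 : ENNReal).toReal ≤ ENNReal.ofReal J := by
      rw [Measure.volume_eq_prod, ← Measure.prod_restrict]
      refine (lintegral_prod_le _).trans ?_
      calc _ ≤ ∫⁻ x in cube d, ENNReal.ofReal J := by
            refine lintegral_mono fun x => ?_
            calc _ ≤ ∫⁻ y in cube d, ENNReal.ofReal (radG lam M ‖x - y‖) := by
                  refine lintegral_mono fun y => ?_
                  have ht := trunc_le lam M h0 (x - y)
                  simp only [ENNReal.toReal_ofNat, ENNReal.rpow_two]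
                  rw [Real.enorm_eq_ofReal (sub_nonneg.2 (min_le_right _ _)),
                    ← ENNReal.ofReal_pow (sub_nonneg.2 (min_le_right _ _))]
                  refine ENNReal.ofReal_le_ofReal (le_of_eq_of_le ?_ ht)
                  congr 1
                  rcases le_total M (euclNorm (x - y) ^ (-lam)) with h | h
                  · rw [min_eq_left h, max_eq_left (by linarith)]
                  · rw [min_eq_right h, max_eq_right (by linarith), sub_self]
              _ ≤ ∫⁻ y, ENNReal.ofReal (radG lam M ‖x - y‖) := setLIntegral_le_lintegral _ _
              _ = ENNReal.ofReal J := by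
                  rw [← hshiftv x, ofReal_integral_eq_lintegral_ofReal (hshift x)
                    (Eventually.of_forall fun y => radG_nonneg _ _ _)]
        _ = ENNReal.ofReal J := by simp [hvol]
    calc _ ≤ (ENNReal.ofReal ((K + 1) * M ^ (2 - (d : ℝ) / lam))) ^ (1 / (2 : ENNReal).toReal) :=
          ENNReal.rpow_le_rpow (hbd.trans (ENNReal.ofReal_le_ofReal hJle)) (by simp)
      _ = _ := by
          rw [ENNReal.ofReal_rpow_of_nonneg (by positivity) (by simp)]
          congr 1
          rw [ENNReal.toReal_ofNat, Real.mul_rpow (by positivity) (by positivity),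
            Real.sqrt_eq_rpow, ← Real.rpow_mul hM.le]
          congr 2
          field_simp
end
end

section
/- Let Q⁺ be a closed subset of Q = [0,1]^d, φ = 1_{Q⁺}, p ≥ 1, and let Nₙ be the number of grid cells Q_{n,ī} having nonempty intersection with the boundary ∂Q⁺. Then ‖φ − φₙ‖^p_{L^p(Q)} ≤ n^{−d} Nₙ. In particular, if there exist constants C > 0 and β ∈ [0,d) with Nₙ ≤ C n^{β} for all n (as holds when the upper box-counting dimension of ∂Q⁺ is less than β), then ‖φ − φₙ‖_{L^p(Q)} ≤ C^{1/p} n^{−(d−β)/p}. -/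
open MeasureTheory Set ProbabilityTheory Filter

noncomputable section

lemma cell_measurable (d n : ℕ) (i : Fin d → Fin n) : MeasurableSet (cell d n i) :=
  MeasurableSet.univ_pi fun _ => measurableSet_Ico

lemma cell_volume_real (d n : ℕ) (hn : 0 < n) (i : Fin d → Fin n) :
    volume.real (cell d n i) = ((n : ℝ) ^ d)⁻¹ := by
  have hn' : (0:ℝ) < n := by exact_mod_cast hn
  have h := Real.volume_pi_Ico_toReal (a := fun k => (i k : ℝ) / n)
    (b := fun k => ((i k : ℝ) + 1) / n) (fun k => by
      change (i k : ℝ) / n ≤ ((i k : ℝ) + 1) / n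
      gcongr; linarith)
  have h2 : ∀ k, ((i k : ℝ) + 1) / n - (i k : ℝ) / n = (n : ℝ)⁻¹ := fun k => by
    field_simp; ring
  simp only [h2, Finset.prod_const, Finset.card_univ, Fintype.card_fin, inv_pow] at h
  exact h

lemma cell_volume_ne_top (d n : ℕ) (i : Fin d → Fin n) : volume (cell d n i) ≠ ⊤ := by
  unfold cell
  rw [Real.volume_pi_Ico]
  exact ENNReal.prod_ne_top fun _ _ => ENNReal.ofReal_ne_top

lemma mem_cell_iff (d n : ℕ) (hn : 0 < n) (i : Fin d → Fin n) (x : Fin d → ℝ)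
    (hx : ∀ k, 0 ≤ x k) : x ∈ cell d n i ↔ ∀ k, ⌊x k * n⌋₊ = (i k : ℕ) := by
  have hn' : (0:ℝ) < n := by exact_mod_cast hn
  simp only [cell, Set.mem_univ_pi, Set.mem_Ico]
  refine forall_congr' fun k => ?_
  rw [Nat.floor_eq_iff (by have := hx k; positivity), div_le_iff₀ hn', lt_div_iff₀ hn']

lemma cellAvg_indicator (d n : ℕ) (Qp : Set (Fin d → ℝ)) (hQp : IsClosed Qp)
    (i : Fin d → Fin n) :
    cellAvg d n (Qp.indicator fun _ => (1:ℝ)) i = (n : ℝ) ^ d * volume.real (cell d n i ∩ Qp) := by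
  unfold cellAvg
  rw [setIntegral_indicator hQp.measurableSet]
  simp

lemma cell_dichotomy (d n : ℕ) (Qp : Set (Fin d → ℝ)) (hQp : IsClosed Qp)
    (i : Fin d → Fin n) (h : ¬ (cell d n i ∩ frontier Qp).Nonempty) :
    cell d n i ⊆ Qp ∨ cell d n i ⊆ Qpᶜ := by
  have hc : IsPreconnected (cell d n i) :=
    (convex_pi (𝕜 := ℝ) fun k _ => convex_Ico _ _).isPreconnected
  rw [isPreconnected_iff_subset_of_disjoint] at hc
  have hcov : cell d n i ⊆ interior Qp ∪ Qpᶜ := by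
    intro x hx
    by_contra hx2
    simp only [Set.mem_union, Set.mem_compl_iff, not_or, not_not] at hx2
    exact h ⟨x, hx, by rw [hQp.frontier_eq]; exact ⟨hx2.2, hx2.1⟩⟩
  have hdis : cell d n i ∩ (interior Qp ∩ Qpᶜ) = ∅ := by
    ext x
    simp only [Set.mem_inter_iff, Set.mem_compl_iff, Set.mem_empty_iff_false, iff_false]
    rintro ⟨_, h1, h2⟩
    exact h2 (interior_subset h1)
  rcases hc (interior Qp) Qpᶜ isOpen_interior hQp.isOpen_compl hcov hdis with h1 | h1
  · exact Or.inl (h1.trans interior_subset)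
  · exact Or.inr h1

lemma step_bound (d : ℕ) (Qp : Set (Fin d → ℝ)) (hQp : IsClosed Qp)
    (p : ℝ) (hp : 1 ≤ p) (n : ℕ) (hn : 0 < n) :
      (∫ x in cube d,
          |Qp.indicator (fun _ => (1:ℝ)) x
            - stepApprox d n (Qp.indicator fun _ => (1:ℝ)) x| ^ p)
        ≤ ((n : ℝ) ^ d)⁻¹ *
            ({i : Fin d → Fin n | (cell d n i ∩ frontier Qp).Nonempty}.ncard : ℝ) := by
  classical
  have hn' : (0:ℝ) < n := by exact_mod_cast hn
  set S : Finset (Fin d → Fin n) :=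
    Finset.univ.filter fun i => (cell d n i ∩ frontier Qp).Nonempty with hS
  have hcard : {i : Fin d → Fin n | (cell d n i ∩ frontier Qp).Nonempty}.ncard = S.card := by
    rw [← Set.ncard_coe_finset]
    congr 1
    ext i
    simp [hS]
  set g : (Fin d → ℝ) → ℝ := fun x => ∑ i ∈ S, (cell d n i).indicator (fun _ => (1:ℝ)) x with hg
  have hgi1 : ∀ i ∈ S, Integrable ((cell d n i).indicator (fun _ => (1:ℝ))) volume := fun i _ =>
    (integrable_indicator_iff (cell_measurable d n i)).2
      (integrableOn_const (cell_volume_ne_top d n i))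
  have hgi : Integrable g volume := integrable_finsetSum S hgi1
  have hg0 : ∀ x, 0 ≤ g x := fun x =>
    Finset.sum_nonneg fun i _ => Set.indicator_nonneg (fun _ _ => zero_le_one) x
  have hgint : ∫ x, g x = ((n : ℝ) ^ d)⁻¹ * (S.card : ℝ) := by
    rw [hg, integral_finsetSum S hgi1]
    simp only [integral_indicator_const _ (cell_measurable d n _), cell_volume_real d n hn]
    simp [mul_comm]
  rw [hcard, ← hgint]
  have hae : (Set.univ.pi fun k : Fin d => Set.Ico (0:ℝ) 1) =ᵐ[volume] cube d :=
    Measure.univ_pi_Ico_ae_eq_Icc (f := (0 : Fin d → ℝ)) (g := 1)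
  rw [← setIntegral_congr_set hae]
  refine le_trans ?_ (setIntegral_le_integral hgi (Filter.Eventually.of_forall hg0)
    (s := Set.univ.pi fun k : Fin d => Set.Ico (0:ℝ) 1))
  refine integral_mono_of_nonneg (Filter.Eventually.of_forall fun x => by positivity)
    hgi.integrableOn ?_
  refine (ae_restrict_iff' (MeasurableSet.univ_pi fun _ => measurableSet_Ico)).2
    (Filter.Eventually.of_forall fun x hx => ?_)
  have hx0 : ∀ k, 0 ≤ x k := fun k => (hx k trivial).1
  have hx1 : ∀ k, x k < 1 := fun k => (hx k trivial).2
  let i : Fin d → Fin n := fun k => ⟨⌊x k * n⌋₊, by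
    rw [Nat.floor_lt (by have := hx0 k; positivity)]
    nlinarith [hx1 k]⟩
  have hxi : x ∈ cell d n i := (mem_cell_iff d n hn i x hx0).2 fun k => rfl
  have huniq : ∀ j, x ∈ cell d n j → j = i := fun j hj => by
    funext k
    exact Fin.ext ((mem_cell_iff d n hn j x hx0).1 hj k).symm
  have hstep : stepApprox d n (Qp.indicator fun _ => (1:ℝ)) x
      = (n : ℝ) ^ d * volume.real (cell d n i ∩ Qp) := by
    rw [← cellAvg_indicator d n Qp hQp i]
    unfold stepApprox stepOf
    rw [Finset.sum_eq_single i]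
    · rw [Set.indicator_of_mem hxi]
    · intro j _ hj
      exact Set.indicator_of_notMem (fun h => hj (huniq j h)) _
    · simp
  have hnd : (0:ℝ) < (n:ℝ) ^ d := by positivity
  show |_| ^ p ≤ g x
  rw [hstep]
  by_cases hi : (cell d n i ∩ frontier Qp).Nonempty
  · have h1 : 1 ≤ g x := by
      have := Finset.single_le_sum (f := fun j => (cell d n j).indicator (fun _ => (1:ℝ)) x)
        (fun j _ => Set.indicator_nonneg (fun _ _ => zero_le_one) x)
        (show i ∈ S by simp [hS, hi])
      simpa [Set.indicator_of_mem hxi] using this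
    refine le_trans (Real.rpow_le_one (abs_nonneg _) ?_ (by linarith)) h1
    have hv : volume.real (cell d n i ∩ Qp) ≤ ((n : ℝ) ^ d)⁻¹ := by
      rw [← cell_volume_real d n hn i]
      exact measureReal_mono Set.inter_subset_left (cell_volume_ne_top d n i)
    have ha1 : (n : ℝ) ^ d * volume.real (cell d n i ∩ Qp) ≤ 1 := by
      calc _ ≤ (n : ℝ) ^ d * ((n : ℝ) ^ d)⁻¹ := by gcongr
        _ = 1 := mul_inv_cancel₀ hnd.ne'
    have ha0 : 0 ≤ (n : ℝ) ^ d * volume.real (cell d n i ∩ Qp) := by positivity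
    by_cases hxQ : x ∈ Qp
    · rw [Set.indicator_of_mem hxQ, abs_le]; constructor <;> linarith
    · rw [Set.indicator_of_notMem hxQ, abs_le]; constructor <;> linarith
  · have hz : Qp.indicator (fun _ => (1:ℝ)) x
        - (n : ℝ) ^ d * volume.real (cell d n i ∩ Qp) = 0 := by
      rcases cell_dichotomy d n Qp hQp i hi with h | h
      · rw [Set.inter_eq_left.2 h, cell_volume_real d n hn, Set.indicator_of_mem (h hxi),
          mul_inv_cancel₀ hnd.ne', sub_self]
      · have he : cell d n i ∩ Qp = ∅ := (Set.disjoint_left.2 fun y hy => h hy).inter_eq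
        rw [he, Set.indicator_of_notMem (h hxi)]
        simp
    rw [hz, abs_zero, Real.zero_rpow (by linarith)]
    exact hg0 x

/-- Lemma 4.3: for `φ = 1_{Q⁺}` the indicator of a closed set
`Q⁺ ⊆ Q`, with `Nₙ` the number of grid cells meeting `∂Q⁺`:
`‖φ − φₙ‖^p_{L^p(Q)} ≤ n^{−d} Nₙ`; and if `Nₙ ≤ C n^β` with `β ∈ [0,d)`, then
`‖φ − φₙ‖_{L^p(Q)} ≤ C^{1/p} n^{−(d−β)/p}`. -/
theorem indicator_step_approx_rate
    (d : ℕ) (hd : 0 < d) (Qp : Set (Fin d → ℝ)) (hQp : IsClosed Qp)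
    (hsub : Qp ⊆ cube d) (p : ℝ) (hp : 1 ≤ p) :
    (∀ n : ℕ, 0 < n →
      (∫ x in cube d,
          |Qp.indicator (fun _ => (1:ℝ)) x
            - stepApprox d n (Qp.indicator fun _ => (1:ℝ)) x| ^ p)
        ≤ ((n : ℝ) ^ d)⁻¹ *
            ({i : Fin d → Fin n | (cell d n i ∩ frontier Qp).Nonempty}.ncard : ℝ)) ∧
    (∀ C β : ℝ, 0 < C → β ∈ Set.Ico (0:ℝ) (d : ℝ) →
      (∀ n : ℕ, 0 < n →
        ({i : Fin d → Fin n | (cell d n i ∩ frontier Qp).Nonempty}.ncard : ℝ)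
          ≤ C * (n : ℝ) ^ β) →
      ∀ n : ℕ, 0 < n →
        (∫ x in cube d,
            |Qp.indicator (fun _ => (1:ℝ)) x
              - stepApprox d n (Qp.indicator fun _ => (1:ℝ)) x| ^ p) ^ (1 / p)
          ≤ C ^ (1 / p) * (n : ℝ) ^ (-((d : ℝ) - β) / p)) := by
  refine ⟨fun n hn => step_bound d Qp hQp p hp n hn, ?_⟩
  intro C β hC _ hN n hn
  have hn' : (0:ℝ) < n := by exact_mod_cast hn
  have hp0 : 0 < p := by linarith
  have h1 := step_bound d Qp hQp p hp n hn
  have h2 : ((n : ℝ) ^ d)⁻¹ *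
      ({i : Fin d → Fin n | (cell d n i ∩ frontier Qp).Nonempty}.ncard : ℝ)
      ≤ C * (n : ℝ) ^ (-((d : ℝ) - β)) := by
    calc _ ≤ ((n : ℝ) ^ d)⁻¹ * (C * (n : ℝ) ^ β) := by
          gcongr
          exact hN n hn
      _ = C * (n : ℝ) ^ (-((d : ℝ) - β)) := by
          rw [neg_sub, Real.rpow_sub hn', Real.rpow_natCast]
          ring
  have h3 := Real.rpow_le_rpow
    (integral_nonneg fun x => Real.rpow_nonneg (abs_nonneg _) p) (h1.trans h2)
    (z := 1 / p) (by positivity)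
  refine h3.trans (le_of_eq ?_)
  rw [Real.mul_rpow hC.le (by positivity), ← Real.rpow_mul hn'.le, mul_one_div]
end
end
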